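/- For all integers n, p ≥ 1, the binomial coefficient C(n + p² − 1, p² − 1) equals Σ_λ |SSYT(λ,p)|², where λ ranges over all partitions of n into at most p parts and |SSYT(λ,p)| is the number of semistandard tableaux of shape λ with entries in {1,…,p}. -/

import Mathlib

open scoped Classical

noncomputable section

/-- Row (0-indexed) of the `k`-th box (0-indexed, row-major numbering) of the Ferrers
diagram of `lam`: the number of indices `i` with `λ_0 + ⋯ + λ_i ≤ k`. -/
def rowOf (p : ℕ) (lam : Fin p → ℕ) (k : ℕ) : ℕ :=
  (Finset.univ.filter fun i : Fin p => (∑ j ∈ Finset.univ.filter (· ≤ i), lam j) ≤ k).card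

/-- Column (0-indexed) of the `k`-th box of the Ferrers diagram of `lam`. -/
def colOf (p : ℕ) (lam : Fin p → ℕ) (k : ℕ) : ℕ :=
  k - ∑ j ∈ Finset.univ.filter (fun j : Fin p => (j : ℕ) < rowOf p lam k), lam j

/-- A tableau (word, identified via row-major numbering of the boxes) of shape `λ` is
semistandard: entries weakly increase along each row and strictly increase down each
column. -/
def IsSemistandard (n p : ℕ) (lam : Fin p → ℕ) (t : Fin n → Fin p) : Prop :=
  (∀ k k' : Fin n, rowOf p lam (k : ℕ) = rowOf p lam (k' : ℕ) → (k : ℕ) ≤ (k' : ℕ) →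
    t k ≤ t k') ∧
  (∀ k k' : Fin n, colOf p lam (k : ℕ) = colOf p lam (k' : ℕ) →
    rowOf p lam (k : ℕ) < rowOf p lam (k' : ℕ) → t k < t k')

/-- The set `SSYT(λ,p)` of semistandard tableaux of shape `λ` with entries in `[p]`. -/
abbrev SSYT (n p : ℕ) (lam : Fin p → ℕ) : Type :=
  {t : Fin n → Fin p // IsSemistandard n p lam t}

/-- Removal of the first row of a partition. -/
def shift (l : ℕ →₀ ℕ) : ℕ →₀ ℕ := l.comapDomain Nat.succ Nat.succ_injective.injOn

/-- Insertion of a new first row. -/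
def consRow (a : ℕ) (l : ℕ →₀ ℕ) : ℕ →₀ ℕ := Finsupp.single 0 a + l.mapDomain Nat.succ

@[simp] lemma shift_apply (l : ℕ →₀ ℕ) (i : ℕ) : shift l i = l (i + 1) := rfl

@[simp] lemma consRow_zero (a : ℕ) (l : ℕ →₀ ℕ) : consRow a l 0 = a := by
  simp [consRow, Finsupp.mapDomain_of_notMem_range]

@[simp] lemma consRow_succ (a : ℕ) (l : ℕ →₀ ℕ) (i : ℕ) : consRow a l (i + 1) = l i := by
  simpa [consRow] using Finsupp.mapDomain_apply Nat.succ_injective l i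

@[simp] lemma shift_consRow (a : ℕ) (l : ℕ →₀ ℕ) : shift (consRow a l) = l := by
  ext i; simp

lemma consRow_shift (l : ℕ →₀ ℕ) : consRow (l 0) (shift l) = l := by
  ext i; cases i <;> simp

lemma degree_consRow (a : ℕ) (l : ℕ →₀ ℕ) : (consRow a l).degree = a + l.degree := by
  simp [consRow, Finsupp.degree_mapDomain]

lemma degree_eq_add_shift (l : ℕ →₀ ℕ) : l.degree = l 0 + (shift l).degree := by
  conv_lhs => rw [← consRow_shift l, degree_consRow]

lemma le_iff_zero_shift {l m : ℕ →₀ ℕ} : l ≤ m ↔ l 0 ≤ m 0 ∧ shift l ≤ shift m := by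
  constructor
  · exact fun h => ⟨h 0, fun i => h (i + 1)⟩
  · rintro ⟨h0, h⟩ (_ | i)
    · exact h0
    · exact h i

lemma shift_sup (l m : ℕ →₀ ℕ) : shift (l ⊔ m) = shift l ⊔ shift m := by
  ext i; rfl

lemma degree_sup_add_degree_inf (l m : ℕ →₀ ℕ) :
    (l ⊔ m).degree + (l ⊓ m).degree = l.degree + m.degree := by
  rw [← map_add, ← map_add]
  congr 1
  ext i
  simp only [Finsupp.add_apply, Finsupp.sup_apply, Finsupp.inf_apply]
  exact max_add_min _ _

/-- Only finitely many shapes arise from `m` by adding a horizontal strip of size `k`. -/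
lemma finite_horizontalStrip (m : ℕ →₀ ℕ) (k : ℕ) :
    {l : ℕ →₀ ℕ | m ≤ l ∧ shift l ≤ m ∧ l.degree = m.degree + k}.Finite := by
  refine Set.Finite.of_injOn (f := shift) (t := Set.Iic m) (fun l hl => hl.2.1) ?_
    (Set.finite_Iic m)
  rintro l ⟨-, -, hl⟩ l' ⟨-, -, hl'⟩ h
  rw [← consRow_shift l, ← consRow_shift l', h]
  congr 1
  have h1 := degree_eq_add_shift l
  have h2 := degree_eq_add_shift l'
  rw [h] at h1
  omega

/-- The finset of shapes obtained from `m` by adding a horizontal strip of size `k`. -/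
def addStrip (m : ℕ →₀ ℕ) (k : ℕ) : Finset (ℕ →₀ ℕ) := (finite_horizontalStrip m k).toFinset

lemma mem_addStrip {m l : ℕ →₀ ℕ} {k : ℕ} :
    l ∈ addStrip m k ↔ m ≤ l ∧ shift l ≤ m ∧ l.degree = m.degree + k := by
  simp [addStrip]

/-- The number of chains of `p` horizontal strips from the empty shape to `l`. -/
def stripCount : ℕ → (ℕ →₀ ℕ) → ℕ
  | 0, l => if l = 0 then 1 else 0
  | p + 1, l => ∑ m ∈ Finset.Icc (shift l) l, stripCount p m

lemma stripCount_eq_zero_of_lt {p : ℕ} {l : ℕ →₀ ℕ} {i : ℕ} (hi : p ≤ i) (hl : l i ≠ 0) :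
    stripCount p l = 0 := by
  induction p generalizing l i with
  | zero =>
    rw [stripCount, if_neg]
    rintro rfl
    exact hl rfl
  | succ p ih =>
    obtain ⟨i, rfl⟩ : ∃ j, i = j + 1 := ⟨i - 1, by omega⟩
    refine Finset.sum_eq_zero fun m hm => ih (i := i) (by omega) ?_
    have := (Finset.mem_Icc.1 hm).1 i
    rw [shift_apply] at this
    omega

lemma reflect_mem_Icc {s t x : ℕ →₀ ℕ} (hs : s ≤ x) (ht : x ≤ t) :
    s ≤ s + t - x ∧ s + t - x ≤ t ∧ s + t - (s + t - x) = x ∧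
      (s + t - x).degree + x.degree = s.degree + t.degree := by
  have hs' : ∀ i, s i ≤ x i := hs
  have ht' : ∀ i, x i ≤ t i := ht
  have hadd : s + t - x + x = s + t := by
    ext i
    simp only [Finsupp.add_apply, Finsupp.tsub_apply]
    have := ht' i
    omega
  refine ⟨fun i => ?_, fun i => ?_, ?_, ?_⟩
  · simp only [Finsupp.add_apply, Finsupp.tsub_apply]
    have := ht' i
    omega
  · simp only [Finsupp.add_apply, Finsupp.tsub_apply]
    have := hs' i
    omega
  · ext i
    simp only [Finsupp.add_apply, Finsupp.tsub_apply]
    have := ht' i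
    omega
  · rw [← map_add, ← map_add, hadd]

/-- The commutation of adding and removing horizontal strips. -/
lemma sum_addStrip_sum_Icc (f : (ℕ →₀ ℕ) → ℕ) (m : ℕ →₀ ℕ) (k : ℕ) :
    ∑ l ∈ addStrip m k, ∑ n ∈ Finset.Icc (shift l) l, f n =
      ∑ i ∈ Finset.range (k + 1), ∑ r ∈ Finset.Icc (shift m) m, ∑ n ∈ addStrip r i, f n := by
  simp_rw [Finset.sum_sigma']
  refine Finset.sum_bij'
    (fun x _ => ⟨k - (x.1 0 - (m ⊔ x.2) 0), shift (m ⊔ x.2) + m ⊓ x.2 - shift x.1, x.2⟩)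
    (fun y _ => ⟨consRow ((m ⊔ y.2.2) 0 + (k - y.1))
      (shift (m ⊔ y.2.2) + m ⊓ y.2.2 - y.2.1), y.2.2⟩) ?_ ?_ ?_ ?_ ?_
  · rintro ⟨l, n⟩ h
    simp only [Finset.mem_sigma, mem_addStrip, Finset.mem_Icc, Finset.mem_range] at h ⊢
    obtain ⟨⟨h1, h2, h3⟩, h4, h5⟩ := h
    obtain ⟨hl0, hl⟩ := le_iff_zero_shift.1 (sup_le h1 h5)
    obtain ⟨r1, r2, -, r4⟩ := reflect_mem_Icc hl (le_inf h2 h4)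
    have hd := degree_sup_add_degree_inf m n
    have hd1 := degree_eq_add_shift (m ⊔ n)
    have hd2 := degree_eq_add_shift l
    have hd3 := Finsupp.degree_mono r2
    have hd4 := Finsupp.degree_mono (inf_le_right : m ⊓ n ≤ n)
    rw [shift_sup] at *
    refine ⟨by omega, ⟨le_sup_left.trans r1, r2.trans inf_le_left⟩, r2.trans inf_le_right,
      le_sup_right.trans r1, by omega⟩
  · rintro ⟨i, r, n⟩ h
    simp only [Finset.mem_sigma, mem_addStrip, Finset.mem_Icc, Finset.mem_range] at h ⊢
    obtain ⟨h1, ⟨h2, h3⟩, h4, h5, h6⟩ := h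
    obtain ⟨r1, r2, -, r4⟩ := reflect_mem_Icc (s := shift (m ⊔ n)) (t := m ⊓ n) (x := r)
      (by rw [shift_sup]; exact sup_le h2 h5) (le_inf h3 h4)
    have hd := degree_sup_add_degree_inf m n
    have hd1 := degree_eq_add_shift (m ⊔ n)
    have hle : m ⊔ n ≤ consRow ((m ⊔ n) 0 + (k - i)) (shift (m ⊔ n) + m ⊓ n - r) := by
      rw [le_iff_zero_shift, consRow_zero, shift_consRow]
      exact ⟨Nat.le_add_right _ _, r1⟩
    rw [shift_consRow, degree_consRow]
    exact ⟨⟨le_sup_left.trans hle, r2.trans inf_le_left, by omega⟩, r2.trans inf_le_right,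
      le_sup_right.trans hle⟩
  · rintro ⟨l, n⟩ h
    simp only [Finset.mem_sigma, mem_addStrip, Finset.mem_Icc] at h
    obtain ⟨⟨h1, h2, h3⟩, h4, h5⟩ := h
    obtain ⟨hl0, hl⟩ := le_iff_zero_shift.1 (sup_le h1 h5)
    obtain ⟨r1, r2, r3, r4⟩ := reflect_mem_Icc hl (le_inf h2 h4)
    have hd := degree_sup_add_degree_inf m n
    have hd1 := degree_eq_add_shift (m ⊔ n)
    have hd2 := degree_eq_add_shift l
    have hd4 := Finsupp.degree_mono h4
    have hd5 := Finsupp.degree_mono (inf_le_right : m ⊓ n ≤ n)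
    have hd6 := Finsupp.degree_mono r2
    simp only [r3]
    rw [show (m ⊔ n) 0 + (k - (k - (l 0 - (m ⊔ n) 0))) = l 0 by omega, consRow_shift]
  · rintro ⟨i, r, n⟩ h
    simp only [Finset.mem_sigma, mem_addStrip, Finset.mem_Icc, Finset.mem_range] at h
    obtain ⟨h1, ⟨h2, h3⟩, h4, h5, h6⟩ := h
    obtain ⟨r1, r2, r3, r4⟩ := reflect_mem_Icc (s := shift (m ⊔ n)) (t := m ⊓ n) (x := r)
      (by rw [shift_sup]; exact sup_le h2 h5) (le_inf h3 h4)
    simp only [shift_consRow, r3, consRow_zero]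
    rw [show k - ((m ⊔ n) 0 + (k - i) - (m ⊔ n) 0) = i by omega]
  · simp

lemma multichoose_eq_coeff (q n : ℕ) :
    (q.multichoose n : ℤ) = PowerSeries.coeff n ((PowerSeries.mk 1 : PowerSeries ℤ) ^ q) := by
  cases q with
  | zero => cases n <;> simp [PowerSeries.coeff_one]
  | succ q =>
    rw [PowerSeries.mk_one_pow_eq_mk_choose_add, PowerSeries.coeff_mk, Nat.multichoose_eq,
      show q + 1 + n - 1 = q + n by omega, Nat.choose_symm_add]

lemma multichoose_add (a b n : ℕ) :
    (a + b).multichoose n =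
      ∑ i ∈ Finset.range (n + 1), a.multichoose i * b.multichoose (n - i) := by
  zify
  simp_rw [multichoose_eq_coeff]
  rw [pow_add, PowerSeries.coeff_mul, Finset.Nat.sum_antidiagonal_eq_sum_range_succ_mk]

/-- The Pieri rule, specialised to counting. -/
lemma sum_addStrip_stripCount (p : ℕ) (m : ℕ →₀ ℕ) (k : ℕ) :
    ∑ l ∈ addStrip m k, stripCount p l = p.multichoose k * stripCount p m := by
  induction p generalizing m k with
  | zero =>
    simp only [stripCount, Finset.sum_ite_eq', mem_addStrip]
    have : (m ≤ 0 ∧ shift 0 ≤ m ∧ Finsupp.degree (0 : ℕ →₀ ℕ) = m.degree + k) ↔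
        m = 0 ∧ k = 0 := by
      constructor
      · rintro ⟨h, -, h'⟩
        rw [map_zero] at h'
        exact ⟨le_antisymm h bot_le, by omega⟩
      · rintro ⟨rfl, rfl⟩
        exact ⟨le_rfl, fun _ => le_rfl, rfl⟩
    rw [if_congr this rfl rfl]
    cases k <;> simp
  | succ p ih =>
    simp only [stripCount]
    rw [sum_addStrip_sum_Icc]
    simp_rw [ih, ← Finset.mul_sum]
    rw [← Finset.sum_mul, multichoose_add p 1]
    simp

lemma mem_finsuppAntidiag_iff_degree {q n : ℕ} {l : ℕ →₀ ℕ} :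
    l ∈ (Finset.range q).finsuppAntidiag n ↔ l.support ⊆ Finset.range q ∧ l.degree = n := by
  rw [Finset.mem_finsuppAntidiag, and_comm]
  refine and_congr_right fun h => ?_
  rw [Finsupp.degree_apply, Finset.sum_subset h]
  simp

/-- The Cauchy identity, specialised to counting. -/
lemma sum_stripCount_mul_stripCount (p q n : ℕ) :
    ∑ l ∈ (Finset.range q).finsuppAntidiag n, stripCount p l * stripCount q l =
      (p * q).multichoose n := by
  induction p generalizing n with
  | zero =>
    simp only [stripCount, ite_mul, one_mul, zero_mul, Finset.sum_ite_eq']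
    have h0 : stripCount q 0 = 1 := by
      induction q with
      | zero => simp [stripCount]
      | succ q ih =>
        have : shift 0 = 0 := by ext i; rfl
        simp [stripCount, this, ih]
    cases n <;> simp [h0, Finset.mem_finsuppAntidiag]
  | succ p ih =>
    have hswap : ∑ l ∈ (Finset.range q).finsuppAntidiag n, stripCount (p + 1) l * stripCount q l =
        ∑ m ∈ (Finset.range (n + 1)).biUnion (fun d => (Finset.range q).finsuppAntidiag d),
          ∑ l ∈ addStrip m (n - m.degree) with l ∈ (Finset.range q).finsuppAntidiag n,
            stripCount p m * stripCount q l := by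
      simp_rw [stripCount, Finset.sum_mul]
      refine Finset.sum_comm' fun l m => ?_
      simp only [Finset.mem_biUnion, Finset.mem_filter, mem_addStrip, Finset.mem_Icc,
        mem_finsuppAntidiag_iff_degree, Finset.mem_range]
      constructor
      · rintro ⟨⟨h1, h2⟩, h3, h4⟩
        have hd := Finsupp.degree_mono h4
        exact ⟨⟨⟨h4, h3, by omega⟩, h1, h2⟩, m.degree, by omega,
          (Finsupp.support_mono h4).trans h1, rfl⟩
      · rintro ⟨⟨⟨h4, h3, -⟩, h1, h2⟩, -⟩
        exact ⟨⟨h1, h2⟩, h3, h4⟩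
    rw [hswap, Finset.sum_biUnion, Nat.succ_mul, multichoose_add]
    · refine Finset.sum_congr rfl fun d hd => ?_
      rw [← ih d, Finset.sum_mul]
      refine Finset.sum_congr rfl fun m hm => ?_
      obtain ⟨h1, rfl⟩ := mem_finsuppAntidiag_iff_degree.1 hm
      rw [← Finset.mul_sum, mul_assoc, mul_comm (stripCount q m), ← sum_addStrip_stripCount]
      congr 1
      refine Finset.sum_filter_of_ne fun l hl hne => ?_
      obtain ⟨-, -, hdeg⟩ := mem_addStrip.1 hl
      rw [Finset.mem_range] at hd
      refine mem_finsuppAntidiag_iff_degree.2 ⟨fun i hi => ?_, by omega⟩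
      by_contra hiq
      exact hne (stripCount_eq_zero_of_lt (by simpa using hiq) (Finsupp.mem_support_iff.1 hi))
    · intro d _ d' _ hdd
      refine Finset.disjoint_left.2 fun m hm hm' => hdd ?_
      rw [mem_finsuppAntidiag_iff_degree] at hm hm'
      exact hm.2.symm.trans hm'.2

/-- The chains of `p` horizontal strips from the empty shape to `l` (Gelfand–Tsetlin patterns). -/
abbrev StripChain (p : ℕ) (l : ℕ →₀ ℕ) : Type :=
  {a : ℕ → ℕ →₀ ℕ // a 0 = 0 ∧ (∀ j < p, shift (a (j + 1)) ≤ a j ∧ a j ≤ a (j + 1)) ∧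
    ∀ j, p ≤ j → a j = l}

/-- Extension of a chain by one more horizontal strip. -/
def StripChain.extend {p : ℕ} {l : ℕ →₀ ℕ}
    (x : Σ m : Finset.Icc (shift l) l, StripChain p (m : ℕ →₀ ℕ)) : StripChain (p + 1) l :=
  ⟨fun j => if j ≤ p then x.2.1 j else l, by
    obtain ⟨⟨m, hm⟩, a, h0, h1, h2⟩ := x
    rw [Finset.mem_Icc] at hm
    refine ⟨by simpa using h0, fun j hj => ?_, fun j hj => if_neg (by omega)⟩
    rcases (Nat.lt_succ_iff.1 hj).lt_or_eq with h | rfl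
    · simpa only [if_pos h.le, if_pos (Nat.succ_le_of_lt h)] using h1 j h
    · simpa [h2 j le_rfl] using hm⟩

lemma StripChain.extend_bijective (p : ℕ) (l : ℕ →₀ ℕ) :
    Function.Bijective (StripChain.extend (p := p) (l := l)) := by
  constructor
  · rintro ⟨⟨m, hm⟩, a, h0, h1, h2⟩ ⟨⟨m', hm'⟩, a', h0', h1', h2'⟩ h
    have heq : ∀ j ≤ p, a j = a' j := fun j hj => by
      simpa [StripChain.extend, hj] using congrFun (congrArg Subtype.val h) j
    obtain rfl : m = m' := (h2 p le_rfl).symm.trans ((heq p le_rfl).trans (h2' p le_rfl))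
    obtain rfl : a = a' := by
      funext j
      rcases le_total j p with hj | hj
      · exact heq j hj
      · rw [h2 j hj, h2' j hj]
    rfl
  · rintro ⟨a, h0, h1, h2⟩
    refine ⟨⟨⟨a p, ?_⟩, fun j => a (min j p), ?_, fun j hj => ?_, fun j hj => ?_⟩, ?_⟩
    · rw [Finset.mem_Icc, ← h2 (p + 1) le_rfl]
      exact h1 p (Nat.lt_succ_self p)
    · simpa using h0
    · simpa only [min_eq_left hj.le, min_eq_left (Nat.succ_le_of_lt hj)] using h1 j (by omega)
    · simp [hj]
    · refine Subtype.ext (funext fun j => ?_)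
      by_cases hj : j ≤ p
      · simp [StripChain.extend, hj]
      · simpa [StripChain.extend, hj] using (h2 j (by omega)).symm

lemma finite_stripChain_and_card (p : ℕ) (l : ℕ →₀ ℕ) :
    Finite (StripChain p l) ∧ Nat.card (StripChain p l) = stripCount p l := by
  induction p generalizing l with
  | zero =>
    have hs : Subsingleton (StripChain 0 l) :=
      ⟨fun a b => Subtype.ext (funext fun j =>
        (a.2.2.2 j (Nat.zero_le j)).trans (b.2.2.2 j (Nat.zero_le j)).symm)⟩
    refine ⟨inferInstance, ?_⟩
    by_cases hl : l = 0
    · subst hl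
      have : Nonempty (StripChain 0 (0 : ℕ →₀ ℕ)) := ⟨⟨fun _ => 0, rfl, by simp, by simp⟩⟩
      rw [Nat.card_unique, stripCount, if_pos rfl]
    · have : IsEmpty (StripChain 0 l) := ⟨fun a => hl ((a.2.2.2 0 le_rfl).symm.trans a.2.1)⟩
      simp [stripCount, hl]
  | succ p ih =>
    have hb := StripChain.extend_bijective p l
    have : ∀ m : Finset.Icc (shift l) l, Finite (StripChain p (m : ℕ →₀ ℕ)) := fun m => (ih m).1
    refine ⟨Finite.of_surjective _ hb.2, ?_⟩
    rw [← Nat.card_eq_of_bijective _ hb, Nat.card_sigma, stripCount,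
      ← Finset.sum_coe_sort (Finset.Icc (shift l) l) (stripCount p)]
    exact Finset.sum_congr rfl fun m _ => (ih m).2

lemma lt_card_filter_range_iff {N c : ℕ} {Q : ℕ → Prop} [DecidablePred Q]
    (hQ : ∀ a b, a ≤ b → b < N → Q b → Q a)
    (hc : c < N) : c < ((Finset.range N).filter Q).card ↔ Q c := by
  constructor
  · intro h
    by_contra hn
    have hsub : (Finset.range N).filter Q ⊆ Finset.range c := fun b hb => by
      rw [Finset.mem_filter, Finset.mem_range] at hb
      rw [Finset.mem_range]
      by_contra hcb
      exact hn (hQ c b (by omega) hb.1 hb.2)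
    have := Finset.card_le_card hsub
    rw [Finset.card_range] at this
    omega
  · intro h
    have hsub : Finset.range (c + 1) ⊆ (Finset.range N).filter Q := fun b hb => by
      rw [Finset.mem_range] at hb
      exact Finset.mem_filter.2 ⟨Finset.mem_range.2 (by omega), hQ b c (by omega) hc h⟩
    have := Finset.card_le_card hsub
    rw [Finset.card_range] at this
    omega

/-- A vector of row lengths as a finitely supported function. -/
def rowLengths {p : ℕ} (lam : Fin p → ℕ) : ℕ →₀ ℕ :=
  Finsupp.onFinset (Finset.range p) (fun i => if h : i < p then lam ⟨i, h⟩ else 0) fun i hi => by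
    by_contra h
    exact hi (dif_neg (by simpa using h))

lemma rowLengths_of_lt {p : ℕ} (lam : Fin p → ℕ) {i : ℕ} (h : i < p) :
    rowLengths lam i = lam ⟨i, h⟩ := dif_pos h

lemma rowLengths_of_le {p : ℕ} (lam : Fin p → ℕ) {i : ℕ} (h : p ≤ i) :
    rowLengths lam i = 0 := dif_neg (by omega)

/-- The number of boxes in the first `i` rows. -/
def rowStart (l : ℕ →₀ ℕ) (i : ℕ) : ℕ := ∑ j ∈ Finset.range i, l j

lemma rowStart_succ (l : ℕ →₀ ℕ) (i : ℕ) : rowStart l (i + 1) = rowStart l i + l i :=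
  Finset.sum_range_succ _ _

lemma rowStart_mono (l : ℕ →₀ ℕ) : Monotone (rowStart l) :=
  monotone_nat_of_le_succ fun i => by rw [rowStart_succ]; omega

lemma sum_filter_val_lt {p : ℕ} (lam : Fin p → ℕ) {i : ℕ} (hi : i ≤ p) :
    ∑ j ∈ Finset.univ.filter (fun j : Fin p => (j : ℕ) < i), lam j =
      rowStart (rowLengths lam) i := by
  rw [rowStart, Finset.sum_filter]
  have : ∀ j : Fin p, (if (j : ℕ) < i then lam j else 0) =
      (fun j : ℕ => if j < i then rowLengths lam j else 0) j := fun j => by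
    simp [rowLengths_of_lt lam j.2]
  rw [Finset.sum_congr rfl fun j _ => this j,
    Fin.sum_univ_eq_sum_range (fun j : ℕ => if j < i then rowLengths lam j else 0) p,
    ← Finset.sum_filter]
  congr 1
  ext j
  simp only [Finset.mem_filter, Finset.mem_range]
  omega

lemma rowOf_eq_card_filter_range {p : ℕ} (lam : Fin p → ℕ) (k : ℕ) :
    rowOf p lam k =
      ((Finset.range p).filter fun i => rowStart (rowLengths lam) (i + 1) ≤ k).card := by
  have h : ∀ i : Fin p, ∑ j ∈ Finset.univ.filter (· ≤ i), lam j =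
      rowStart (rowLengths lam) (i + 1) := fun i => by
    rw [← sum_filter_val_lt lam (Nat.succ_le_of_lt i.2)]
    congr 1
    ext j
    simp
  simp only [rowOf, h]
  rw [Finset.card_filter, Finset.card_filter]
  exact Fin.sum_univ_eq_sum_range (fun i => if rowStart (rowLengths lam) (i + 1) ≤ k then 1 else 0) p

lemma lt_rowOf_iff {p : ℕ} (lam : Fin p → ℕ) {k i : ℕ} (hi : i < p) :
    i < rowOf p lam k ↔ rowStart (rowLengths lam) (i + 1) ≤ k := by
  rw [rowOf_eq_card_filter_range]
  exact lt_card_filter_range_iff (Q := fun i => rowStart (rowLengths lam) (i + 1) ≤ k)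
    (fun a b hab _ hb => (rowStart_mono _ (by omega)).trans hb) hi

lemma rowOf_le {p : ℕ} (lam : Fin p → ℕ) (k : ℕ) : rowOf p lam k ≤ p := by
  simpa [rowOf] using Finset.card_filter_le (Finset.univ : Finset (Fin p)) _

lemma colOf_eq {p : ℕ} (lam : Fin p → ℕ) (k : ℕ) :
    colOf p lam k = k - rowStart (rowLengths lam) (rowOf p lam k) := by
  rw [colOf, sum_filter_val_lt lam (rowOf_le lam k)]

lemma rowOf_rowStart_add {p : ℕ} (lam : Fin p → ℕ) {i c : ℕ} (hc : c < rowLengths lam i) :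
    rowOf p lam (rowStart (rowLengths lam) i + c) = i := by
  have hi : i < p := by
    by_contra h
    rw [rowLengths_of_le lam (by omega)] at hc
    omega
  have h1 : ¬ i < rowOf p lam (rowStart (rowLengths lam) i + c) := by
    rw [lt_rowOf_iff lam hi, rowStart_succ]
    omega
  rcases Nat.eq_zero_or_pos i with rfl | hpos
  · omega
  · have h2 := (lt_rowOf_iff lam (k := rowStart (rowLengths lam) i + c) (i := i - 1) (by omega)).2
      (by rw [Nat.sub_add_cancel hpos]; omega)
    omega

lemma colOf_rowStart_add {p : ℕ} (lam : Fin p → ℕ) {i c : ℕ} (hc : c < rowLengths lam i) :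
    colOf p lam (rowStart (rowLengths lam) i + c) = c := by
  rw [colOf_eq, rowOf_rowStart_add lam hc]
  omega

lemma rowStart_add_lt {p : ℕ} (lam : Fin p → ℕ) {i c : ℕ} (hc : c < rowLengths lam i) :
    rowStart (rowLengths lam) i + c < rowStart (rowLengths lam) p := by
  have hi : i < p := by
    by_contra h
    rw [rowLengths_of_le lam (by omega)] at hc
    omega
  have := rowStart_mono (rowLengths lam) (Nat.succ_le_of_lt hi)
  rw [Nat.succ_eq_add_one, rowStart_succ] at this
  omega

lemma rowStart_rowOf_add_colOf {p : ℕ} (lam : Fin p → ℕ) {k : ℕ}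
    (hk : k < rowStart (rowLengths lam) p) :
    rowStart (rowLengths lam) (rowOf p lam k) + colOf p lam k = k ∧
      colOf p lam k < rowLengths lam (rowOf p lam k) := by
  have hp : p ≠ 0 := by
    rintro rfl
    simp [rowStart] at hk
  have hlt : rowOf p lam k < p := by
    have h := (lt_rowOf_iff lam (k := k) (i := p - 1) (by omega)).not.2
      (by rw [Nat.sub_add_cancel (by omega)]; omega)
    omega
  have h1 := (lt_rowOf_iff lam (k := k) hlt).not.1 (lt_irrefl _)
  have h2 : rowStart (rowLengths lam) (rowOf p lam k) ≤ k := by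
    rcases Nat.eq_zero_or_pos (rowOf p lam k) with h0 | hpos
    · simp [h0, rowStart]
    · have h := (lt_rowOf_iff lam (k := k) (i := rowOf p lam k - 1) (by omega)).1 (by omega)
      rwa [Nat.sub_add_cancel hpos] at h
  rw [rowStart_succ] at h1
  rw [colOf_eq]
  omega

lemma StripChain.apply_succ_le {p : ℕ} {l : ℕ →₀ ℕ} (a : StripChain p l) {j : ℕ} (hj : j < p) {i i' : ℕ}
    (hi : i < i') : a.1 (j + 1) i' ≤ a.1 j i := by
  have hanti : Antitone (a.1 (j + 1)) := antitone_nat_of_succ_le fun i =>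
    ((a.2.2.1 j hj).1 i).trans ((a.2.2.1 j hj).2 i)
  exact (hanti (Nat.succ_le_of_lt hi)).trans ((a.2.2.1 j hj).1 i)

lemma StripChain.mono {p : ℕ} {l : ℕ →₀ ℕ} (a : StripChain p l) : Monotone a.1 :=
  monotone_nat_of_le_succ fun j => by
    rcases lt_or_ge j p with hj | hj
    · exact (a.2.2.1 j hj).2
    · rw [a.2.2.2 j hj, a.2.2.2 (j + 1) (by omega)]

/-- The entry of a word at position `k`, and `0` beyond its end. -/
def entry {n p : ℕ} (t : Fin n → Fin p) (k : ℕ) : ℕ := if h : k < n then (t ⟨k, h⟩ : ℕ) else 0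

lemma entry_of_lt {n p : ℕ} (t : Fin n → Fin p) {k : ℕ} (h : k < n) :
    entry t k = (t ⟨k, h⟩ : ℕ) := dif_pos h

/-- The shape formed by the entries of a filling that are smaller than `j`. -/
def subshape {n p : ℕ} (lam : Fin p → ℕ) (t : Fin n → Fin p) (j : ℕ) : ℕ →₀ ℕ :=
  Finsupp.onFinset (Finset.range p)
    (fun i => ((Finset.range (rowLengths lam i)).filter
      fun c => entry t (rowStart (rowLengths lam) i + c) < j).card) fun i hi => by
    by_contra h
    refine hi ?_
    rw [rowLengths_of_le lam (by simpa using h)]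
    rfl

lemma subshape_apply {n p : ℕ} (lam : Fin p → ℕ) (t : Fin n → Fin p) (j i : ℕ) :
    subshape lam t j i = ((Finset.range (rowLengths lam i)).filter
      fun c => entry t (rowStart (rowLengths lam) i + c) < j).card := rfl

lemma lt_subshape_iff {n p : ℕ} {lam : Fin p → ℕ} (hn : rowStart (rowLengths lam) p = n)
    {t : Fin n → Fin p} (ht : IsSemistandard n p lam t) {j i c : ℕ}
    (hc : c < rowLengths lam i) :
    c < subshape lam t j i ↔ entry t (rowStart (rowLengths lam) i + c) < j := by
  rw [subshape_apply]
  refine lt_card_filter_range_iff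
    (Q := fun c => entry t (rowStart (rowLengths lam) i + c) < j) (fun a b hab hb hbj => ?_) hc
  have hbn := (rowStart_add_lt lam hb).trans_eq hn
  have han := (rowStart_add_lt lam (hab.trans_lt hb)).trans_eq hn
  rw [entry_of_lt t hbn] at hbj
  rw [entry_of_lt t han]
  refine lt_of_le_of_lt (Fin.le_def.1 (ht.1 ⟨_, han⟩ ⟨_, hbn⟩ ?_ ?_)) hbj
  · rw [rowOf_rowStart_add lam hb, rowOf_rowStart_add lam (hab.trans_lt hb)]
  · exact Nat.add_le_add_left hab _

/-- The chain of shapes attached to a semistandard tableau. -/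
def SSYT.toStripChain {n p : ℕ} {lam : Fin p → ℕ} (hn : rowStart (rowLengths lam) p = n)
    (hlam : ∀ i, rowLengths lam (i + 1) ≤ rowLengths lam i) (t : SSYT n p lam) :
    StripChain p (rowLengths lam) :=
  ⟨subshape lam t.1, by
    ext i
    simp [subshape_apply], by
    refine fun j hj => ⟨fun i => ?_, fun i => ?_⟩
    · rw [shift_apply, subshape_apply, subshape_apply]
      refine Finset.card_le_card fun c hc => ?_
      rw [Finset.mem_filter, Finset.mem_range] at hc ⊢
      obtain ⟨hc, hcj⟩ := hc
      have hc' := hc.trans_le (hlam i)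
      have h1 := (rowStart_add_lt lam hc).trans_eq hn
      have h2 := (rowStart_add_lt lam hc').trans_eq hn
      refine ⟨hc', ?_⟩
      rw [entry_of_lt _ h1] at hcj
      rw [entry_of_lt _ h2]
      have := Fin.lt_def.1 (t.2.2 ⟨_, h2⟩ ⟨_, h1⟩
        (by rw [colOf_rowStart_add lam hc, colOf_rowStart_add lam hc'])
        (by rw [rowOf_rowStart_add lam hc, rowOf_rowStart_add lam hc']; omega))
      omega
    · rw [subshape_apply, subshape_apply]
      exact Finset.card_le_card
        (Finset.monotone_filter_right _ fun c _ hc => Nat.lt_succ_of_lt hc), by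
    intro j hj
    ext i
    rw [subshape_apply, Finset.filter_true_of_mem, Finset.card_range]
    intro c hc
    have h := (rowStart_add_lt lam (Finset.mem_range.1 hc)).trans_eq hn
    rw [entry_of_lt _ h]
    exact (t.1 _).2.trans_le hj⟩

lemma SSYT.toStripChain_injective {n p : ℕ} {lam : Fin p → ℕ}
    (hn : rowStart (rowLengths lam) p = n)
    (hlam : ∀ i, rowLengths lam (i + 1) ≤ rowLengths lam i) :
    Function.Injective (SSYT.toStripChain hn hlam) := by
  intro t t' h
  refine Subtype.ext (funext fun k => Fin.ext ?_)
  obtain ⟨hk, hc⟩ := rowStart_rowOf_add_colOf lam (k.2.trans_eq hn.symm)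
  have key : ∀ j, (t.1 k : ℕ) < j ↔ (t'.1 k : ℕ) < j := fun j => by
    have hj : subshape lam t.1 j = subshape lam t'.1 j := congrFun (congrArg Subtype.val h) j
    have h1 := lt_subshape_iff hn t.2 (j := j) hc
    have h2 := lt_subshape_iff hn t'.2 (j := j) hc
    rw [hk, entry_of_lt _ k.2] at h1 h2
    rw [← h1, ← h2, hj]
  have h1 := key (t.1 k)
  have h2 := key (t'.1 k)
  omega

lemma SSYT.toStripChain_surjective {n p : ℕ} {lam : Fin p → ℕ}
    (hn : rowStart (rowLengths lam) p = n)
    (hlam : ∀ i, rowLengths lam (i + 1) ≤ rowLengths lam i) :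
    Function.Surjective (SSYT.toStripChain hn hlam) := by
  intro a
  let e : ℕ → ℕ → ℕ := fun i c => ((Finset.range p).filter fun j => a.1 (j + 1) i ≤ c).card
  have he : ∀ i c j, c < rowLengths lam i → (e i c < j ↔ c < a.1 j i) := by
    intro i c j hc
    have hap : a.1 p i = rowLengths lam i := by rw [a.2.2.2 p le_rfl]
    have hlt : ∀ j < p, (j < e i c ↔ a.1 (j + 1) i ≤ c) := fun j hj =>
      lt_card_filter_range_iff (Q := fun j => a.1 (j + 1) i ≤ c)
        (fun x y hxy _ hy => (a.mono (Nat.succ_le_succ hxy) i).trans hy) hj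
    have hep : e i c ≤ p := by
      simpa using Finset.card_filter_le (Finset.range p) fun j => a.1 (j + 1) i ≤ c
    rcases j with _ | j
    · simp [a.2.1]
    · rcases lt_or_ge j p with hj | hj
      · have := hlt j hj
        omega
      · rw [a.2.2.2 (j + 1) (by omega)]
        omega
  have hep : ∀ i c, c < rowLengths lam i → e i c < p := fun i c hc => by
    rwa [he i c p hc, a.2.2.2 p le_rfl]
  have hbox : ∀ k : Fin n, colOf p lam k < rowLengths lam (rowOf p lam k) := fun k =>
    (rowStart_rowOf_add_colOf lam (k.2.trans_eq hn.symm)).2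
  let w : Fin n → Fin p := fun k => ⟨e (rowOf p lam k) (colOf p lam k), hep _ _ (hbox k)⟩
  refine ⟨⟨w, ?_, ?_⟩, ?_⟩
  · intro k k' hr hkk
    rw [Fin.mk_le_mk]
    refine Nat.lt_succ_iff.1 ((he _ _ _ (hbox k)).2 ?_)
    have h := (he _ _ _ (hbox k')).1 (Nat.lt_succ_self _)
    rw [hr]
    refine lt_of_le_of_lt ?_ h
    rw [colOf_eq, colOf_eq, hr]
    omega
  · intro k k' hcol hr
    rw [Fin.mk_lt_mk]
    refine (he _ _ _ (hbox k)).2 ?_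
    have h := (he _ _ _ (hbox k')).1 (Nat.lt_succ_self _)
    rw [hcol]
    exact h.trans_le (StripChain.apply_succ_le a (hep _ _ (hbox k')) hr)
  · refine Subtype.ext (funext fun j => Finsupp.ext fun i => ?_)
    refine (subshape_apply _ _ _ _).trans ?_
    have hle : a.1 j i ≤ rowLengths lam i := by
      have h := a.mono (le_max_left j p) i
      rwa [a.2.2.2 (max j p) (le_max_right _ _)] at h
    refine Eq.trans (congrArg Finset.card ?_) (Finset.card_range _)
    ext c
    rw [Finset.mem_filter, Finset.mem_range, Finset.mem_range]
    have hiff : c < rowLengths lam i → 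
        (entry w (rowStart (rowLengths lam) i + c) < j ↔ c < a.1 j i) := fun hc => by
      rw [entry_of_lt _ ((rowStart_add_lt lam hc).trans_eq hn)]
      simp only [w, rowOf_rowStart_add lam hc, colOf_rowStart_add lam hc]
      exact he i c j hc
    exact ⟨fun h => (hiff h.1).1 h.2, fun h => ⟨h.trans_le hle, (hiff (h.trans_le hle)).2 h⟩⟩

lemma card_SSYT {n p : ℕ} {lam : Fin p → ℕ} (hn : ∑ i, lam i = n)
    (hlam : ∀ i j : Fin p, i ≤ j → lam j ≤ lam i) :
    Fintype.card (SSYT n p lam) = stripCount p (rowLengths lam) := by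
  have hn' : rowStart (rowLengths lam) p = n := by
    rw [← sum_filter_val_lt lam le_rfl, ← hn]
    simp
  have hlam' : ∀ i, rowLengths lam (i + 1) ≤ rowLengths lam i := fun i => by
    rcases lt_or_ge (i + 1) p with h | h
    · rw [rowLengths_of_lt lam h, rowLengths_of_lt lam (by omega)]
      exact hlam _ _ (Nat.le_succ i)
    · rw [rowLengths_of_le lam h]
      exact Nat.zero_le _
  rw [← (finite_stripChain_and_card p (rowLengths lam)).2, ← Nat.card_eq_fintype_card]
  exact Nat.card_eq_of_bijective _
    ⟨SSYT.toStripChain_injective hn' hlam', SSYT.toStripChain_surjective hn' hlam'⟩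

lemma antitone_of_stripCount_ne_zero {p : ℕ} {l : ℕ →₀ ℕ} (h : stripCount p l ≠ 0) :
    Antitone l := by
  cases p with
  | zero =>
    have : l = 0 := by
      by_contra hl
      exact h (if_neg hl)
    subst this
    exact fun _ _ _ => le_rfl
  | succ p =>
    obtain ⟨m, hm, -⟩ := Finset.exists_ne_zero_of_sum_ne_zero h
    rw [Finset.mem_Icc] at hm
    exact antitone_nat_of_succ_le fun i => (hm.1.trans hm.2) i

/-- `C(n + p² - 1, p² - 1) = Σ_λ |SSYT(λ,p)|²`, the sum over all partitions
`λ` of `n` into at most `p` parts (encoded with entries in `Fin (n+1)`, as all parts are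
at most `n`). -/
theorem stmt_6 (n p : ℕ) (hn : 1 ≤ n) (hp : 1 ≤ p) :
    (n + p ^ 2 - 1).choose (p ^ 2 - 1) =
      ∑ lam ∈ (Finset.univ : Finset (Fin p → Fin (n + 1))).filter
          (fun lam => (∀ i j : Fin p, i ≤ j → (lam j : ℕ) ≤ (lam i : ℕ)) ∧
            ∑ i, (lam i : ℕ) = n),
        (Fintype.card (SSYT n p (fun i => (lam i : ℕ)))) ^ 2 := by
  rw [← Nat.choose_symm_of_eq_add (show n + p ^ 2 - 1 = n + (p ^ 2 - 1) by
      have := Nat.pow_pos (n := 2) hp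
      omega),
    show n + p ^ 2 - 1 = p * p + n - 1 by rw [sq, add_comm], ← Nat.multichoose_eq,
    ← sum_stripCount_mul_stripCount]
  symm
  refine Finset.sum_bij_ne_zero (fun lam _ _ => rowLengths fun i => (lam i : ℕ)) ?_ ?_ ?_ ?_
  · intro lam hlam _
    rw [Finset.mem_filter] at hlam
    rw [Finset.mem_finsuppAntidiag]
    refine ⟨?_, Finsupp.support_onFinset_subset⟩
    have h := sum_filter_val_lt (fun i => (lam i : ℕ)) (le_refl p)
    exact (h.symm.trans (by simp)).trans hlam.2.2
  · intro lam _ _ lam' _ _ h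
    funext i
    have := DFunLike.congr_fun h (i : ℕ)
    rw [rowLengths_of_lt _ i.2, rowLengths_of_lt _ i.2] at this
    exact Fin.ext this
  · intro l hl hne
    have hanti := antitone_of_stripCount_ne_zero (left_ne_zero_of_mul hne)
    obtain ⟨hsum, hsupp⟩ := Finset.mem_finsuppAntidiag.1 hl
    have hdeg := (mem_finsuppAntidiag_iff_degree.1 hl).2
    have hle : ∀ i, l i < n + 1 := fun i => Nat.lt_succ_of_le (hdeg ▸ Finsupp.le_degree i l)
    have hrow : rowLengths (fun i : Fin p => l i) = l := by
      ext i
      rcases lt_or_ge i p with hi | hi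
      · rw [rowLengths_of_lt _ hi]
      · rw [rowLengths_of_le _ hi]
        by_contra hne'
        have := Finset.mem_range.1 (hsupp (Finsupp.mem_support_iff.2 (Ne.symm hne')))
        omega
    have hsum' : ∑ i : Fin p, l i = n := by
      rw [Fin.sum_univ_eq_sum_range (fun i => l i) p]
      exact hsum
    have hanti' : ∀ i j : Fin p, i ≤ j → l j ≤ l i := fun i j hij => hanti hij
    refine ⟨fun i => ⟨l i, hle i⟩, Finset.mem_filter.2 ⟨Finset.mem_univ _, hanti', hsum'⟩, ?_, hrow⟩
    rw [card_SSYT hsum' hanti', hrow, sq]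
    exact hne
  · intro lam hlam _
    rw [Finset.mem_filter] at hlam
    rw [card_SSYT hlam.2.2 hlam.2.1, sq]
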